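/- Let n > 2 be an integer and let X : D_{2ⁿ} → ℤ be such that the eta quotient η^X is holomorphic, i.e., Σ_{d|2ⁿ} (2ⁿ·gcd(d,t)²)/(d·gcd(t²,2ⁿ))·X_d ≥ 0 for every t ∈ D_{2ⁿ}. Then |X_1| + |X_{2ⁿ}| ≤ 2·Σ_{d|2ⁿ} X_d. -/

import Mathlib

open Finset

/-- `24` times the order of the eta quotient `η^X` at the cusp `1/t` of `Γ₀(N)`:
`∑_{d ∣ N} (N · gcd(d,t)²)/(d · gcd(t²,N)) · X_d`. -/
def etaOrd (N : ℕ) (X : ℕ → ℤ) (t : ℕ) : ℚ :=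
  ∑ d ∈ N.divisors,
    ((N : ℚ) * (Nat.gcd d t : ℚ) ^ 2 / ((d : ℚ) * (Nat.gcd (t ^ 2) N : ℚ))) * (X d : ℚ)

/-- The eta quotient `η^X` on `Γ₀(N)` is holomorphic: all cusp orders are nonnegative. -/
def IsHolEta (N : ℕ) (X : ℕ → ℤ) : Prop :=
  ∀ t ∈ N.divisors, 0 ≤ etaOrd N X t

/-- The exponent vector `X` is supported on the divisors of `N`, i.e. `X : D_N → ℤ`. -/
def SuppIn (N : ℕ) (X : ℕ → ℤ) : Prop :=
  ∀ d : ℕ, ¬ d ∣ N → X d = 0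

/-- The kernel `2 ^ (-|i - j|)`, written with truncated subtraction. -/
def distWeight (i j : ℕ) : ℚ := (1 / 2) ^ ((i - j) + (j - i))

lemma distWeight_add_right (i k : ℕ) : distWeight i (i + k) = (1 / 2) ^ k := by
  simp [distWeight]

lemma distWeight_add_left (j k : ℕ) : distWeight (j + k) j = (1 / 2) ^ k := by
  simp [distWeight]

lemma gcd_two_pow_sq (i j : ℕ) :
    (Nat.gcd (2 ^ i) (2 ^ j) : ℚ) ^ 2 = 2 ^ i * 2 ^ j * distWeight i j := by
  rcases le_total i j with h | h
  · obtain ⟨k, rfl⟩ := Nat.exists_eq_add_of_le h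
    rw [Nat.gcd_eq_left (pow_dvd_pow 2 h), distWeight_add_right]
    push_cast
    rw [pow_add, one_div, inv_pow]
    field_simp
  · obtain ⟨k, rfl⟩ := Nat.exists_eq_add_of_le h
    rw [Nat.gcd_eq_right (pow_dvd_pow 2 h), distWeight_add_left]
    push_cast
    rw [pow_add, one_div, inv_pow]
    field_simp

lemma sum_divisors_two_pow {M : Type*} [AddCommMonoid M] (n : ℕ) (f : ℕ → M) :
    ∑ d ∈ (2 ^ n).divisors, f d = ∑ i ∈ range (n + 1), f (2 ^ i) :=
  Nat.sum_divisors_prime_pow Nat.prime_two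

/-- The order of an eta quotient of level `2 ^ n` at the cusp `1 / 2 ^ j`, up to a positive
factor. -/
def scaledOrd (n : ℕ) (X : ℕ → ℤ) (j : ℕ) : ℚ :=
  ∑ i ∈ range (n + 1), distWeight i j * (X (2 ^ i) : ℚ)

lemma etaOrd_two_pow (n : ℕ) (X : ℕ → ℤ) (j : ℕ) :
    etaOrd (2 ^ n) X (2 ^ j) =
      (2 ^ n * 2 ^ j / (Nat.gcd ((2 ^ j) ^ 2) (2 ^ n) : ℚ)) * scaledOrd n X j := by
  rw [etaOrd, scaledOrd, sum_divisors_two_pow, mul_sum]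
  refine sum_congr rfl fun i _ => ?_
  have hg : (Nat.gcd ((2 ^ j) ^ 2) (2 ^ n) : ℚ) ≠ 0 := by
    exact_mod_cast (Nat.gcd_pos_of_pos_right _ (by positivity)).ne'
  rw [gcd_two_pow_sq]
  generalize (Nat.gcd ((2 ^ j) ^ 2) (2 ^ n) : ℚ) = g at *
  push_cast
  field_simp

lemma IsHolEta.scaledOrd_nonneg {n : ℕ} {X : ℕ → ℤ} (h : IsHolEta (2 ^ n) X) {j : ℕ}
    (hj : j ≤ n) : 0 ≤ scaledOrd n X j := by
  have h0 := h (2 ^ j) (Nat.mem_divisors.2 ⟨pow_dvd_pow 2 hj, by positivity⟩)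
  rw [etaOrd_two_pow] at h0
  have hg : (0 : ℚ) < (Nat.gcd ((2 ^ j) ^ 2) (2 ^ n) : ℚ) := by
    exact_mod_cast Nat.gcd_pos_of_pos_right _ (by positivity)
  exact nonneg_of_mul_nonneg_right h0 (by positivity)

lemma sum_distWeight_self (i : ℕ) :
    ∑ j ∈ range (i + 1), distWeight i j = 2 - (1 / 2) ^ i := by
  induction i with
  | zero => norm_num [distWeight]
  | succ i ih =>
    rw [sum_range_succ']
    have h : ∀ j, distWeight (i + 1) (j + 1) = distWeight i j := fun j => by
      simp [distWeight]
    simp only [h, ih]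
    simp only [distWeight, Nat.sub_zero, Nat.zero_sub, add_zero, pow_succ]
    ring

lemma sum_distWeight (i k : ℕ) :
    ∑ j ∈ range (i + k + 1), distWeight i j = 3 - (1 / 2) ^ i - (1 / 2) ^ k := by
  induction k with
  | zero => rw [add_zero, sum_distWeight_self]; ring
  | succ k ih =>
    rw [sum_range_succ, ← add_assoc, ih, add_assoc, distWeight_add_right, pow_succ]
    ring

lemma three_mul_sum_eq (n : ℕ) (X : ℕ → ℤ) :
    3 * ∑ i ∈ range (n + 1), (X (2 ^ i) : ℚ) =
      ∑ j ∈ range (n + 1), scaledOrd n X j + scaledOrd n X 0 + scaledOrd n X n := by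
  simp only [scaledOrd]
  rw [sum_comm, ← sum_add_distrib, ← sum_add_distrib, mul_sum]
  refine sum_congr rfl fun i hi => ?_
  obtain ⟨k, rfl⟩ := Nat.exists_eq_add_of_le (Nat.lt_succ_iff.1 (mem_range.1 hi))
  rw [← sum_mul, sum_distWeight, distWeight_add_right]
  simp only [distWeight, Nat.sub_zero, Nat.zero_sub, add_zero]
  ring

lemma three_mul_first_eq (n : ℕ) (X : ℕ → ℤ) :
    3 * (X 1 : ℚ) = 4 * scaledOrd n X 0 - 2 * scaledOrd n X 1 := by
  simp only [scaledOrd]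
  rw [sum_range_succ', sum_range_succ' (fun i => distWeight i 1 * _), mul_add, mul_add,
    mul_sum, mul_sum, sum_congr rfl (g := fun i => 2 * (distWeight (i + 1) 1 * X (2 ^ (i + 1))))]
  · norm_num [distWeight]
    ring
  · intro i _
    simp only [distWeight, Nat.sub_zero, Nat.zero_sub, add_zero, Nat.add_sub_cancel,
      Nat.sub_eq_zero_of_le (Nat.le_add_left 1 i), pow_succ]
    ring

lemma three_mul_last_eq (n : ℕ) (X : ℕ → ℤ) :
    3 * (X (2 ^ (n + 1)) : ℚ) =
      4 * scaledOrd (n + 1) X (n + 1) - 2 * scaledOrd (n + 1) X n := by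
  simp only [scaledOrd]
  rw [sum_range_succ, sum_range_succ (fun i => distWeight i n * _), mul_add, mul_add,
    mul_sum, mul_sum, sum_congr rfl (g := fun i => 2 * (distWeight i n * X (2 ^ i)))]
  · norm_num [distWeight]
    ring
  · intro i hi
    obtain ⟨k, rfl⟩ := Nat.exists_eq_add_of_le (Nat.lt_succ_iff.1 (mem_range.1 hi))
    rw [add_assoc, distWeight_add_right, distWeight_add_right, pow_succ]
    ring

/-- Lemma: for `n > 2`, a holomorphic eta quotient `η^X` of level dividing `2ⁿ`
satisfies `|X_1| + |X_{2ⁿ}| ≤ 2·σ(X)`. -/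
theorem abs_first_last_le_twice_sigma (n : ℕ) (hn : 2 < n) (X : ℕ → ℤ)
    (hsupp : SuppIn (2 ^ n) X) (hhol : IsHolEta (2 ^ n) X) :
    |X 1| + |X (2 ^ n)| ≤ 2 * ∑ d ∈ (2 ^ n).divisors, X d := by
  obtain ⟨m, rfl⟩ := Nat.exists_eq_add_of_le' (Nat.succ_le_of_lt hn)
  have hb : ∀ j ≤ m + 3, 0 ≤ scaledOrd (m + 3) X j := fun j hj => hhol.scaledOrd_nonneg hj
  have hsum := three_mul_sum_eq (m + 3) X
  rw [sum_range_succ (scaledOrd (m + 3) X), sum_range_succ (scaledOrd (m + 3) X),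
    sum_range_succ' (scaledOrd (m + 3) X), sum_range_succ' (fun j => scaledOrd (m + 3) X (j + 1))]
    at hsum
  have hmid : 0 ≤ ∑ j ∈ range m, scaledOrd (m + 3) X (j + 1 + 1) :=
    sum_nonneg fun j hj => hb _ (by have := mem_range.1 hj; omega)
  have hfirst := three_mul_first_eq (m + 3) X
  have hlast := three_mul_last_eq (m + 2) X
  have h0 := hb 0 (by omega)
  have h1 := hb 1 (by omega)
  have h2 := hb (m + 2) (by omega)
  have h3 := hb (m + 3) le_rfl
  simp only [zero_add, add_assoc, Nat.reduceAdd] at hsum hfirst hlast hmid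
  have habs_first : |(X 1 : ℚ)| ≤
      (4 * scaledOrd (m + 3) X 0 + 2 * scaledOrd (m + 3) X 1) / 3 :=
    abs_le.2 ⟨by linarith, by linarith⟩
  have habs_last : |(X (2 ^ (m + 3)) : ℚ)| ≤
      (4 * scaledOrd (m + 3) X (m + 3) + 2 * scaledOrd (m + 3) X (m + 2)) / 3 :=
    abs_le.2 ⟨by linarith, by linarith⟩
  rw [sum_divisors_two_pow]
  have hq : |(X 1 : ℚ)| + |(X (2 ^ (m + 3)) : ℚ)| ≤
      2 * ∑ i ∈ range (m + 3 + 1), (X (2 ^ i) : ℚ) := by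
    simp only [add_assoc, Nat.reduceAdd]
    linarith
  exact_mod_cast hq
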